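/- Let μ be a non-atomic, σ-finite measure with μ(T) = ∞, and let φ be a deformed exponential such that φ and the constant function u₀ ≡ 1 satisfy condition (C). Then a_φ := inf{u ∈ ℝ : φ(u) > 0} = −∞, and there exists α ∈ (0,1) such that α·φ(u) ≤ φ(u − 1) for all u ∈ ℝ. -/

import Mathlib

open MeasureTheory Filter Set

theorem aux_small {T : Type*} [MeasurableSpace T] (μ : Measure T)
    (hna : ∀ A : Set T, MeasurableSet A → 0 < μ A →
      ∃ B ⊆ A, MeasurableSet B ∧ 0 < μ B ∧ μ B < μ A)
    (A : Set T) (hA : MeasurableSet A) (h0 : 0 < μ A) (hfin : μ A < ⊤) (n : ℕ) :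
    ∃ B ⊆ A, MeasurableSet B ∧ 0 < μ B ∧ 2 ^ n * μ B ≤ μ A := by
  induction n with
  | zero => exact ⟨A, subset_rfl, hA, h0, by simp⟩
  | succ n ih =>
    obtain ⟨B, hBA, hB, hB0, hBn⟩ := ih
    obtain ⟨C, hCB, hC, hC0, hClt⟩ := hna B hB hB0
    have hadd : μ C + μ (B \ C) = μ B := by
      have := measure_inter_add_diff (μ := μ) B hC
      rwa [inter_eq_self_of_subset_right hCB] at this
    rcases le_total (μ C) (μ (B \ C)) with h | h
    · refine ⟨C, hCB.trans hBA, hC, hC0, le_trans ?_ hBn⟩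
      rw [pow_succ, mul_assoc, two_mul, ← hadd]
      gcongr
    · refine ⟨B \ C, diff_subset.trans hBA, hB.diff hC, ?_, le_trans ?_ hBn⟩
      · rw [pos_iff_ne_zero]
        intro hz
        rw [hz, add_zero] at hadd
        exact hClt.ne hadd
      · rw [pow_succ, mul_assoc, two_mul]
        conv_rhs => rw [← hadd]
        gcongr

theorem aux_sierp {T : Type*} [MeasurableSpace T] (μ : Measure T) [SigmaFinite μ]
    (hμinf : μ Set.univ = ⊤)
    (hna : ∀ A : Set T, MeasurableSet A → 0 < μ A →
      ∃ B ⊆ A, MeasurableSet B ∧ 0 < μ B ∧ μ B < μ A)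
    (r : ENNReal) (hr : r ≠ 0) (hrt : r ≠ ⊤) :
    ∃ B, MeasurableSet B ∧ r / 2 ≤ μ B ∧ μ B ≤ r := by
  by_contra! hcon
  have key : ∀ B, MeasurableSet B → μ B ≤ r → μ B < r / 2 := by
    intro B hB hBr
    by_contra! h
    exact absurd hBr (not_le.2 (hcon B hB h))
  have hun : ∀ B C, MeasurableSet B → MeasurableSet C → μ B ≤ r → μ C ≤ r → μ (B ∪ C) ≤ r := by
    intro B C hB hC h1 h2
    calc μ (B ∪ C) ≤ μ B + μ C := measure_union_le _ _
      _ ≤ r / 2 + r / 2 := add_le_add (key B hB h1).le (key C hC h2).le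
      _ = r := ENNReal.add_halves r
  let S : Set ENNReal := {x | ∃ B, MeasurableSet B ∧ μ B ≤ r ∧ μ B = x}
  have hSne : S.Nonempty := ⟨0, ∅, MeasurableSet.empty, by simp, by simp⟩
  obtain ⟨x, -, hx, hxS⟩ := exists_seq_tendsto_sSup hSne (OrderTop.bddAbove S)
  choose f hf hfr hfx using hxS
  have hacc : ∀ n, MeasurableSet (accumulate f n) ∧ μ (accumulate f n) ≤ r := by
    intro n
    induction n with
    | zero => simpa [accumulate] using ⟨hf 0, hfr 0⟩
    | succ n ih =>
      rw [accumulate_succ]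
      exact ⟨ih.1.union (hf _), hun _ _ ih.1 (hf _) ih.2 (hfr _)⟩
  have hlim : Tendsto (fun i => μ (accumulate f i)) atTop (nhds (μ (⋃ i, f i))) :=
    tendsto_measure_iUnion_accumulate
  have hUr : μ (⋃ i, f i) ≤ r := le_of_tendsto' hlim fun n => (hacc n).2
  have hUm : MeasurableSet (⋃ i, f i) := MeasurableSet.iUnion hf
  have hUs : sSup S ≤ μ (⋃ i, f i) := by
    refine le_of_tendsto' hx fun n => ?_
    rw [← hfx n]
    exact measure_mono (subset_iUnion f n)
  have hUt : μ (⋃ i, f i) ≠ ⊤ := ne_top_of_le_ne_top hrt hUr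
  have hcompl : μ (⋃ i, f i)ᶜ = ⊤ := by
    rw [measure_compl hUm hUt, hμinf, ENNReal.top_sub hUt]
  obtain ⟨A, hA, hAsub, hA0, hAt⟩ := Measure.exists_subset_measure_lt_top (μ := μ) (r := 0)
    hUm.compl (by rw [hcompl]; simp)
  obtain ⟨n, hn⟩ : ∃ n : ℕ, μ A ≤ 2 ^ n * r := by
    obtain ⟨n, hn⟩ := ENNReal.exists_nat_mul_gt hr hAt.ne
    refine ⟨n, hn.le.trans ?_⟩
    gcongr
    exact_mod_cast Nat.lt_two_pow_self.le
  obtain ⟨B, hBA, hB, hB0, hBn⟩ := aux_small μ hna A hA hA0 hAt n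
  have hBr : μ B ≤ r :=
    (ENNReal.mul_le_mul_iff_right (by simp) (by simp)).1 (hBn.trans hn)
  have hfinal : μ ((⋃ i, f i) ∪ B) ≤ sSup S :=
    le_sSup ⟨_, hUm.union hB, hun _ _ hUm hB hUr hBr, rfl⟩
  rw [measure_union _ hB] at hfinal
  · have h2 := hfinal.trans hUs
    exact absurd h2 (not_le.2 (ENNReal.lt_add_right hUt hB0.ne'))
  · exact (subset_compl_iff_disjoint_left.1 (hBA.trans hAsub))

theorem aux_mono (φ : ℝ → ℝ) (hconv : ConvexOn ℝ Set.univ φ) (hnonneg : ∀ u, 0 ≤ φ u)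
    (hbot : Tendsto φ atBot (nhds 0)) : Monotone φ := by
  intro x y hxy
  by_contra! h
  have hz : ∀ z < x, φ x ≤ φ z := by
    intro z hz
    have := hconv.le_max_of_mem_Icc (mem_univ z) (mem_univ y) (z := x) ⟨hz.le, hxy⟩
    rcases le_max_iff.1 this with h1 | h1
    · exact h1
    · linarith
  have : φ x ≤ 0 := ge_of_tendsto hbot ((eventually_lt_atBot x).mono hz)
  linarith [hnonneg y]

theorem aux_d {T : Type*} [MeasurableSpace T] (μ : Measure T) [SigmaFinite μ] (φ : ℝ → ℝ)
    (hbot : Tendsto φ atBot (nhds 0)) :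
    ∃ d : T → ℝ, Measurable d ∧ ∫⁻ t, ENNReal.ofReal (φ (d t)) ∂μ < ⊤ := by
  obtain ⟨g, hg0, hgm, hgi⟩ := exists_pos_lintegral_lt_of_sigmaFinite μ (ε := 1) one_ne_zero
  have : ∀ n : ℕ, ∃ v, φ v < 1 / ((n : ℝ) + 1) := fun n =>
    (hbot.eventually_lt_const (by positivity)).exists
  choose v hv using this
  refine ⟨fun t => v ⌈1 / g t⌉₊, ?_, ?_⟩
  · exact (measurable_from_nat (f := v)).comp (Nat.measurable_ceil.comp (hgm.const_div 1))
  · refine lt_of_le_of_lt (lintegral_mono fun t => ?_) (hgi.trans ENNReal.one_lt_top)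
    rw [← ENNReal.ofReal_coe_nnreal]
    apply ENNReal.ofReal_le_ofReal
    refine (hv _).le.trans ?_
    have h1 : ((1 / g t : NNReal) : ℝ) ≤ ⌈1 / g t⌉₊ := by exact_mod_cast Nat.le_ceil (1 / g t)
    have h2 : (0 : ℝ) < g t := hg0 t
    rw [NNReal.coe_div, NNReal.coe_one] at h1
    rw [div_le_iff₀ (by positivity)]
    rw [div_le_iff₀ h2] at h1
    nlinarith

/-- Let `μ` be non-atomic, σ-finite with `μ(T) = ∞`, and `φ` a deformed
exponential such that `φ` and `u₀ ≡ 1` satisfy condition (C). Then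
`a_φ := inf {u : φ(u) > 0} = −∞` (i.e. the set `{u : φ(u) > 0}` is not bounded below),
and there exists `α ∈ (0,1)` with `α φ(u) ≤ φ(u − 1)` for all `u ∈ ℝ`. -/
theorem condC_const_one_infinite_measure
    {T : Type*} [MeasurableSpace T] (μ : Measure T) [SigmaFinite μ]
    (hμinf : μ Set.univ = ⊤)
    (hna : ∀ A : Set T, MeasurableSet A → 0 < μ A →
      ∃ B ⊆ A, MeasurableSet B ∧ 0 < μ B ∧ μ B < μ A)
    (φ : ℝ → ℝ) (hconv : ConvexOn ℝ Set.univ φ) (hnonneg : ∀ u, 0 ≤ φ u)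
    (hbot : Tendsto φ atBot (nhds 0)) (htop : Tendsto φ atTop atTop)
    (hC : ∀ c : T → ℝ, Measurable c →
      (∫⁻ t, ENNReal.ofReal (φ (c t)) ∂μ < ⊤) →
      ∀ lam : ℝ, 0 < lam →
        ∫⁻ t, ENNReal.ofReal (φ (c t + lam * 1)) ∂μ < ⊤) :
    ¬ BddBelow {u : ℝ | 0 < φ u} ∧
    ∃ α : ℝ, α ∈ Set.Ioo (0 : ℝ) 1 ∧ ∀ u : ℝ, α * φ u ≤ φ (u - 1) := by
  have hmono := aux_mono φ hconv hnonneg hbot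
  have hcont : Continuous φ := by
    rw [← continuousOn_univ]
    exact hconv.continuousOn isOpen_univ
  have h1 : ¬ BddBelow {u : ℝ | 0 < φ u} := by
    rintro ⟨a, ha⟩
    have hz : φ (a - 1) = 0 := by
      refine le_antisymm (not_lt.1 fun h => ?_) (hnonneg _)
      have := ha h
      linarith
    obtain ⟨M, hM, hMa⟩ := ((htop.eventually_gt_atTop 0).and (eventually_gt_atTop a)).exists
    have := hC (fun _ => a - 1) measurable_const (by simp [hz]) (M - (a - 1)) (by linarith)
    simp [hμinf, ENNReal.mul_top, hM] at this
  refine ⟨h1, ?_⟩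
  have hpos : ∀ u, 0 < φ u := by
    intro u
    by_contra! h
    refine h1 ⟨u, fun w hw => ?_⟩
    by_contra! hwu
    have := hmono hwu.le
    have : 0 < φ w := hw
    linarith
  by_contra! hcon
  have hex : ∀ n : ℕ, ∃ u, φ (u - 1) < (1 / 4) ^ (n + 1) * φ u := fun n =>
    hcon _ ⟨by positivity, pow_lt_one₀ (by norm_num) (by norm_num) (by omega)⟩
  choose u hu using hex
  have hAex : ∀ n : ℕ, ∃ B, MeasurableSet B ∧
      ENNReal.ofReal ((1 / 2) ^ n / φ (u n - 1)) / 2 ≤ μ B ∧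
      μ B ≤ ENNReal.ofReal ((1 / 2) ^ n / φ (u n - 1)) := fun n =>
    aux_sierp μ hμinf hna _
      (by
        have := hpos (u n - 1)
        rw [Ne, ENNReal.ofReal_eq_zero, not_le]; positivity) ENNReal.ofReal_ne_top
  choose A hAm hAl hAu using hAex
  obtain ⟨d, hdm, hdi⟩ := aux_d μ φ hbot
  classical
  let c : ℕ → T → ℝ := fun n => (A n).piecewise (fun _ => u n - 1) d
  have hcm : ∀ n, Measurable (c n) := fun n => Measurable.piecewise (hAm n) measurable_const hdm
  let G : ℕ → T → ENNReal := fun n => (A n).indicator fun _ => ENNReal.ofReal (φ (u n - 1))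
  have hGm : ∀ n, Measurable (G n) := fun n => measurable_const.indicator (hAm n)
  let F : T → ENNReal := fun t => ENNReal.ofReal (φ (d t)) + ∑' n, G n t
  have hφd : Measurable fun t => ENNReal.ofReal (φ (d t)) :=
    (hcont.measurable.comp hdm).ennreal_ofReal
  have hFm : Measurable F := hφd.add (Measurable.ennreal_tsum hGm)
  have hFi : ∫⁻ t, F t ∂μ < ⊤ := by
    rw [lintegral_add_left hφd, lintegral_tsum fun n => (hGm n).aemeasurable]
    refine ENNReal.add_lt_top.2 ⟨hdi, ?_⟩
    have hle : ∀ n, ∫⁻ t, G n t ∂μ ≤ ENNReal.ofReal ((1 / 2) ^ n) := by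
      intro n
      rw [lintegral_indicator_const (hAm n)]
      calc _ ≤ ENNReal.ofReal (φ (u n - 1)) * ENNReal.ofReal ((1 / 2) ^ n / φ (u n - 1)) := by
            gcongr
            exact hAu n
        _ = _ := by
            rw [← ENNReal.ofReal_mul (hnonneg _), mul_div_cancel₀ _ (hpos _).ne']
    refine (ENNReal.tsum_le_tsum hle).trans_lt ?_
    rw [← ENNReal.ofReal_tsum_of_nonneg (fun n => by positivity)
      (summable_geometric_of_lt_one (by norm_num) (by norm_num))]
    exact ENNReal.ofReal_lt_top
  have hcF : ∀ n t, ENNReal.ofReal (φ (c n t)) ≤ F t := by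
    intro n t
    by_cases ht : t ∈ A n
    · have : ENNReal.ofReal (φ (c n t)) = G n t := by simp [c, G, ht]
      rw [this]
      exact (ENNReal.le_tsum (f := fun n => G n t) n).trans le_add_self
    · have : c n t = d t := by simp [c, ht]
      rw [this]
      exact le_self_add
  have hbdd : ∀ t, F t < ⊤ → BddAbove (range fun n => c n t) := by
    intro t ht
    obtain ⟨M, hM⟩ := (htop.eventually_gt_atTop (F t).toReal).exists
    refine ⟨M, ?_⟩
    rintro _ ⟨n, rfl⟩
    by_contra! h
    have h2 := hmono h.le
    have h3 := (ENNReal.ofReal_le_iff_le_toReal ht.ne).1 (hcF n t)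
    linarith
  have hsup : ∀ t, ENNReal.ofReal (φ (⨆ n, c n t)) ≤ F t := by
    intro t
    rcases eq_or_ne (F t) ⊤ with h | h
    · rw [h]; exact le_top
    · rw [hmono.map_ciSup_of_continuousAt hcont.continuousAt (hbdd t h.lt_top),
        ENNReal.ofReal_le_iff_le_toReal h]
      exact ciSup_le fun n => (ENNReal.ofReal_le_iff_le_toReal h).1 (hcF n t)
  have hfin := hC (fun t => ⨆ n, c n t) (Measurable.iSup hcm)
    ((lintegral_mono hsup).trans_lt hFi) 1 one_pos
  have hae : ∀ᵐ t ∂μ, F t < ⊤ := ae_lt_top hFm hFi.ne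
  have hlow : ∀ n : ℕ, (n : ENNReal) ≤
      ∫⁻ t, ENNReal.ofReal (φ ((⨆ n, c n t) + 1 * 1)) ∂μ := by
    intro n
    have hp := hpos (u n - 1)
    calc (n : ENNReal) = ENNReal.ofReal n := (ENNReal.ofReal_natCast n).symm
      _ ≤ ENNReal.ofReal (φ (u n) * ((1 / 2) ^ n / φ (u n - 1) / 2)) := by
          apply ENNReal.ofReal_le_ofReal
          have h4 : 4 ^ (n + 1) * φ (u n - 1) ≤ φ (u n) := by
            have := (hu n).le
            rw [div_pow, one_pow, one_div, inv_mul_eq_div, le_div_iff₀ (by positivity)] at this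
            linarith
          have h5 : (n : ℝ) ≤ 2 ^ n := by exact_mod_cast Nat.lt_two_pow_self.le
          calc (n : ℝ) ≤ 2 ^ n := h5
            _ ≤ 2 * 2 ^ n := by linarith [pow_pos (two_pos (α := ℝ)) n]
            _ = (4 ^ (n + 1) * φ (u n - 1)) * ((1 / 2) ^ n / φ (u n - 1) / 2) := by
              have : (4 : ℝ) ^ n = 2 ^ n * 2 ^ n := by rw [← mul_pow]; norm_num
              rw [pow_succ, this, div_pow, one_pow]
              field_simp
              norm_num
            _ ≤ _ := by gcongr
      _ = ENNReal.ofReal (φ (u n)) * (ENNReal.ofReal ((1 / 2) ^ n / φ (u n - 1)) / 2) := by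
          rw [ENNReal.ofReal_mul (hnonneg _), ENNReal.ofReal_div_of_pos two_pos]
          simp
      _ ≤ ENNReal.ofReal (φ (u n)) * μ (A n) := by
          gcongr
          exact hAl n
      _ = ∫⁻ t, (A n).indicator (fun _ => ENNReal.ofReal (φ (u n))) t ∂μ :=
          (lintegral_indicator_const (hAm n) _).symm
      _ ≤ _ := by
          apply lintegral_mono_ae
          filter_upwards [hae] with t ht
          by_cases htA : t ∈ A n
          · rw [indicator_of_mem htA]
            apply ENNReal.ofReal_le_ofReal
            apply hmono
            have h6 := le_ciSup (hbdd t ht) n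
            have h7 : c n t = u n - 1 := by simp [c, htA]
            simp only [h7] at h6
            linarith
          · rw [indicator_of_notMem htA]
            exact zero_le
  obtain ⟨N, hN⟩ := ENNReal.exists_nat_gt hfin.ne
  exact absurd (hlow N) (not_le.2 hN)
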